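/- An irreflexive tournament is strongly chordal if and only if it does not contain two arc-disjoint directed triangles. -/

import Mathlib

def StrongOrdering {V : Type*} (A : V → V → Prop) (r : V → V → Prop) : Prop :=
  IsStrictTotalOrder V r ∧
    ∀ a b c d : V, r a b → r c d → A a c → A a d → A b c → A b d

def StronglyChordal {V : Type*} (A : V → V → Prop) : Prop :=
  ∃ r : V → V → Prop, StrongOrdering A r

def DirTriangle {V : Type*} (A : V → V → Prop) (u v w : V) : Prop :=
  u ≠ v ∧ v ≠ w ∧ w ≠ u ∧ A u v ∧ A v w ∧ A w u

section Necessity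

variable {V : Type*} {A r : V → V → Prop}

lemma DirTriangle.rotate {u v w : V} (h : DirTriangle A u v w) : DirTriangle A v w u :=
  ⟨h.2.1, h.2.2.1, h.1, h.2.2.2.2.1, h.2.2.2.2.2, h.2.2.2.1⟩

/-- The three arcs of a triangle, as a set. -/
def triangleArcs (u v w : V) : Set (V × V) := {(u, v), (v, w), (w, u)}

lemma triangleArcs_rotate (u v w : V) : triangleArcs v w u = triangleArcs u v w := by
  ext p
  simp only [triangleArcs, Set.mem_insert_iff, Set.mem_singleton_iff]
  tauto

/-- A triangle can be rotated so that its last vertex is the greatest one. -/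
lemma DirTriangle.exists_last (hr : IsStrictTotalOrder V r) {u v w : V}
    (h : DirTriangle A u v w) :
    ∃ x y z, DirTriangle A x y z ∧ triangleArcs x y z = triangleArcs u v w ∧ r x z ∧ r y z := by
  have tri : ∀ x y, x ≠ y → r x y ∨ r y x := fun x y hxy => by
    rcases trichotomous_of r x y with h | h | h
    · exact Or.inl h
    · exact absurd h hxy
    · exact Or.inr h
  rcases tri u v h.1 with h₁ | h₁
  · rcases tri v w h.2.1 with h₂ | h₂
    · exact ⟨u, v, w, h, rfl, _root_.trans h₁ h₂, h₂⟩
    · exact ⟨w, u, v, h.rotate.rotate, by rw [triangleArcs_rotate, triangleArcs_rotate], h₂, h₁⟩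
  · rcases tri w u h.2.2.1 with h₂ | h₂
    · exact ⟨v, w, u, h.rotate, triangleArcs_rotate _ _ _, h₁, h₂⟩
    · exact ⟨u, v, w, h, rfl, h₂, _root_.trans h₁ h₂⟩

variable (htour : ∀ u v : V, u ≠ v → (A u v ↔ ¬ A v u)) (hirr : ∀ v : V, ¬ A v v)
  (hr : StrongOrdering A r)
include htour hirr hr

/-- The earlier in-neighbours of a vertex dominate no earlier out-neighbour of it. -/
lemma StrongOrdering.adj_of_adj {a b c : V} (hac : r a c) (hbc : r b c) (hab : A a b)
    (h : A a c) : A b c := by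
  have hne : b ≠ c := by
    have := hr.1
    rintro rfl
    exact irrefl_of r b hbc
  by_contra hn
  exact hirr c (hr.2 a c b c hac hbc hab h (by_contra fun h' => hn ((htour _ _ hne).2 h')))

omit hr in
lemma tournament_asymm {x y : V} (h : A x y) (h' : A y x) : False := by
  rcases eq_or_ne x y with rfl | hne
  · exact hirr _ h
  · exact (htour _ _ hne).1 h h'

/-- Every earlier out-neighbour of a vertex dominates every earlier in-neighbour of it. -/
lemma StrongOrdering.adj_of_out_of_in {n x y : V} (hx : r x n) (hy : r y n) (hnx : A n x)
    (hyn : A y n) : A x y := by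
  have asymm : ∀ {x y}, A x y → A y x → False := tournament_asymm htour hirr
  by_contra hxy
  have hne : x ≠ y := by rintro rfl; exact asymm hnx hyn
  have hyx : A y x := by_contra fun h => hxy ((htour _ _ hne).2 h)
  exact asymm hnx (hr.adj_of_adj htour hirr hy hx hyx hyn)

/-- Among the vertices preceding `n`, there cannot be both an arc between out-neighbours of `n`
and an arc between in-neighbours of `n`. -/
lemma StrongOrdering.not_adj_out_of_adj_in {n x y a b : V} (hx : r x n) (hy : r y n) (ha : r a n)
    (hb : r b n) (hnx : A n x) (hny : A n y) (han : A a n) (hbn : A b n) (hxy : A x y)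
    (hab : A a b) : False := by
  have asymm : ∀ {x y}, A x y → A y x → False := tournament_asymm htour hirr
  have := hr.1
  rcases trichotomous_of r y a with h | rfl | h
  · exact asymm han
      (hr.2 x n y a hx h hxy (hr.adj_of_out_of_in htour hirr hx ha hnx han) hny)
  · exact asymm hny han
  · exact asymm hny
      (hr.2 a y b n h hb hab han (hr.adj_of_out_of_in htour hirr hy hb hny hbn))

/-- Two triangles with the same greatest vertex share an arc. -/
lemma StrongOrdering.not_disjoint_of_last_eq {o i p j n : V}
    (h₁ : DirTriangle A o i n) (h₂ : DirTriangle A p j n)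
    (ho : r o n) (hi : r i n) (hp : r p n) (hj : r j n) (hop : o ≠ p) (hij : i ≠ j) : False := by
  obtain ⟨-, -, -, -, hin, hno⟩ := h₁
  obtain ⟨-, -, -, -, hjn, hnp⟩ := h₂
  have total : ∀ {x y}, x ≠ y → A x y ∨ A y x := fun h => or_iff_not_imp_right.2 (htour _ _ h).2
  rcases total hop with h | h <;> rcases total hij with h' | h'
  · exact hr.not_adj_out_of_adj_in htour hirr ho hp hi hj hno hnp hin hjn h h'
  · exact hr.not_adj_out_of_adj_in htour hirr ho hp hj hi hno hnp hjn hin h h'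
  · exact hr.not_adj_out_of_adj_in htour hirr hp ho hi hj hnp hno hin hjn h h'
  · exact hr.not_adj_out_of_adj_in htour hirr hp ho hj hi hnp hno hjn hin h h'

/-- No triangle precedes the greatest vertex of another triangle. -/
lemma StrongOrdering.not_last_lt {o i n x y z : V}
    (h₁ : DirTriangle A o i n) (h₂ : DirTriangle A x y z)
    (ho : r o n) (hi : r i n) (hz : r z n) (hx : r x z) (hy : r y z) : False := by
  have asymm : ∀ {x y}, A x y → A y x → False := tournament_asymm htour hirr
  have := hr.1
  have hxn : r x n := _root_.trans hx hz
  have hyn : r y n := _root_.trans hy hz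
  obtain ⟨-, -, -, -, hin, hno⟩ := h₁
  obtain ⟨-, -, -, hxy, hyz, hzx⟩ := h₂
  have total : ∀ {v}, r v n → A n v ∨ A v n := fun {v} hv => by
    have hne : n ≠ v := by rintro rfl; exact irrefl_of r n hv
    exact or_iff_not_imp_right.2 (htour _ _ hne).2
  have step : ∀ {u v}, r u n → r v n → A u v → A u n → A v n := fun hu hv huv hun =>
    hr.adj_of_adj htour hirr hu hv huv hun
  have out : ∀ {v}, r v n → A n v → A v i := fun hv h =>
    hr.adj_of_out_of_in htour hirr hv hi h hin
  have inn : ∀ {v}, r v n → A v n → A o v := fun hv h =>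
    hr.adj_of_out_of_in htour hirr ho hv hno h
  rcases total hz with hnz | hzn
  · have hny : A n y := (total hyn).resolve_right fun h => asymm hnz (step hyn hz hyz h)
    rcases trichotomous_of r z i with h | rfl | h
    · exact asymm hin (hr.2 y n z i hyn h hyz (out hyn hny) hnz)
    · exact asymm hnz hin
    · exact asymm (out hz hnz) (hr.adj_of_adj htour hirr hy h (out hyn hny) hyz)
  · have hxn' : A x n := step hz hxn hzx hzn
    have hyn' : A y n := step hxn hyn hxy hxn'
    rcases trichotomous_of r z o with h | rfl | h
    · exact asymm hno (hr.2 z o x n h hxn hzx hzn (inn hxn hxn'))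
    · exact asymm hno hzn
    · exact asymm hzx (hr.adj_of_adj htour hirr h hx (inn hxn hxn') (inn hz hzn))

/-- In a strongly chordal tournament, any two directed triangles share an arc. -/
lemma StrongOrdering.triangleArcs_inter_ne_empty {u v w x y z : V}
    (h₁ : DirTriangle A u v w) (h₂ : DirTriangle A x y z) :
    triangleArcs u v w ∩ triangleArcs x y z ≠ ∅ := by
  have := hr.1
  obtain ⟨a, b, c, habc, h, hac, hbc⟩ := h₁.exists_last hr.1
  obtain ⟨d, e, f, hdef, h', hdf, hef⟩ := h₂.exists_last hr.1
  rw [← h, ← h']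
  intro hd
  rcases trichotomous_of r c f with hcf | rfl | hcf
  · exact hr.not_last_lt htour hirr hdef habc hdf hef hcf hac hbc
  · refine hr.not_disjoint_of_last_eq htour hirr habc hdef hac hbc hdf hef ?_ ?_
    · rintro rfl
      exact Set.eq_empty_iff_forall_notMem.1 hd (c, a) (by simp [triangleArcs])
    · rintro rfl
      exact Set.eq_empty_iff_forall_notMem.1 hd (b, c) (by simp [triangleArcs])
  · exact hr.not_last_lt htour hirr habc hdef hac hbc hcf hdf hef

end Necessity

section Sufficiency

variable {V : Type*} {A : V → V → Prop}

/-- A linear order with one arc reversed is strongly chordal. -/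
lemma stronglyChordal_of_reversed_arc [LinearOrder V] {p q : V} (hpq : p < q)
    (hA : ∀ x y, A x y ↔ (x < y ∧ ¬ (x = p ∧ y = q)) ∨ (x = q ∧ y = p)) :
    StronglyChordal A := by
  refine ⟨fun x y => (p ≤ x ∧ x < y ∧ y ≤ q) ∨ (y < x ∧ x < p) ∨ (q < x ∧ x < y) ∨
    (p ≤ x ∧ x ≤ q ∧ (y < p ∨ q < y)) ∨ (x < p ∧ q < y), ?_, ?_⟩
  · refine { trichotomous := ?_, irrefl := ?_, trans := ?_ }
    · intro x y; grind
    · intro x; grind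
    · intro x y z; grind
  · intro a b c d
    simp only [hA]
    grind

/-- A transitive tournament is strongly chordal. -/
lemma stronglyChordal_of_linearOrder [LinearOrder V] (hA : ∀ x y, A x y ↔ x < y) :
    StronglyChordal A := by
  refine ⟨(· < ·), inferInstance, fun a b c d => ?_⟩
  simp only [hA]
  grind

variable (htour : ∀ u v : V, u ≠ v → (A u v ↔ ¬ A v u)) (hirr : ∀ v : V, ¬ A v v)
  (hshare : ∀ u v w x y z, DirTriangle A u v w → DirTriangle A x y z →
    triangleArcs u v w ∩ triangleArcs x y z ≠ ∅)
include htour hirr hshare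

omit hirr in
/-- If two triangles meet in the single arc `(u, v)`, then all triangles contain this arc. -/
lemma mem_triangleArcs_of_two {u v w w' : V} (h : DirTriangle A u v w)
    (h' : DirTriangle A u v w') (hne : w ≠ w') {x y z : V} (ht : DirTriangle A x y z) :
    (u, v) ∈ triangleArcs x y z := by
  have h₁ := Set.nonempty_iff_ne_empty.2 (hshare _ _ _ _ _ _ h ht)
  have h₂ := Set.nonempty_iff_ne_empty.2 (hshare _ _ _ _ _ _ h' ht)
  obtain ⟨⟨a, b⟩, h₁⟩ := h₁
  obtain ⟨⟨c, d⟩, h₂⟩ := h₂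
  simp only [triangleArcs, Set.mem_inter_iff, Set.mem_insert_iff, Set.mem_singleton_iff,
    Prod.mk.injEq, DirTriangle] at *
  grind

omit hirr in
/-- If any two triangles share an arc, then all triangles share a common arc. -/
lemma exists_common_arc {u v w : V} (h : DirTriangle A u v w) :
    ∃ a b m, DirTriangle A b a m ∧
      ∀ x y z, DirTriangle A x y z → (b, a) ∈ triangleArcs x y z := by
  by_cases hall : ∀ x y z, DirTriangle A x y z → (u, v) ∈ triangleArcs x y z
  · exact ⟨v, u, w, h, hall⟩
  push Not at hall
  obtain ⟨x, y, z, ht, hn⟩ := hall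
  have key : (∃ m, m ≠ u ∧ DirTriangle A v w m) ∨ (∃ m, m ≠ v ∧ DirTriangle A w u m) := by
    obtain ⟨⟨c, d⟩, hcd⟩ := Set.nonempty_iff_ne_empty.2 (hshare _ _ _ _ _ _ h ht)
    have r₁ := ht.rotate
    have r₂ := r₁.rotate
    simp only [triangleArcs, Set.mem_inter_iff, Set.mem_insert_iff, Set.mem_singleton_iff,
      Prod.mk.injEq] at hcd hn
    grind
  rcases key with ⟨m, hm, ht⟩ | ⟨m, hm, ht⟩
  · exact ⟨w, v, m, ht, fun _ _ _ hx =>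
      mem_triangleArcs_of_two htour hshare ht h.rotate hm hx⟩
  · exact ⟨u, w, m, ht, fun _ _ _ hx =>
      mem_triangleArcs_of_two htour hshare ht h.rotate.rotate hm hx⟩

/-- If any two triangles share an arc, the tournament is strongly chordal. -/
lemma stronglyChordal_of_share : StronglyChordal A := by
  classical
  have asymm : ∀ {x y}, A x y → A y x → False := tournament_asymm htour hirr
  have total : ∀ {x y}, x ≠ y → A x y ∨ A y x := fun h => or_iff_not_imp_right.2 (htour _ _ h).2
  by_cases hex : ∃ u v w, DirTriangle A u v w
  · obtain ⟨u, v, w, h⟩ := hex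
    obtain ⟨a, b, m, ⟨hba, ham, hmb, aba, aam, amb⟩, hall⟩ :=
      exists_common_arc htour hshare h
    let B : V → V → Prop := fun x y => (A x y ∧ ¬ (x = b ∧ y = a)) ∨ (x = a ∧ y = b)
    have noTri : ∀ x y z, A x y → A y z → A z x → (x = b ∧ y = a) ∨ (y = b ∧ z = a) ∨
        (z = b ∧ x = a) := by
      intro x y z hxy hyz hzx
      have ne : ∀ {s t}, A s t → s ≠ t := by rintro s t hst rfl; exact hirr _ hst
      have := hall x y z ⟨ne hxy, ne hyz, ne hzx, hxy, hyz, hzx⟩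
      simp only [triangleArcs, Set.mem_insert_iff, Set.mem_singleton_iff, Prod.mk.injEq] at this
      grind
    have between : ∀ z, A b z → A z a → False := by
      intro z hbz hza
      have hzm : z ≠ m := by rintro rfl; exact asymm aam hza
      rcases total hzm with hz | hz
      · have := noTri b z m hbz hz amb
        grind
      · have := noTri a m z aam hz hza
        grind
    have hB : IsStrictTotalOrder V B :=
      { trichotomous := by
          intro x y hxy hyx
          by_contra hne
          have := total hne
          grind
        irrefl := by intro x; grind
        trans := by
          intro x y z hxy hyz
          have := noTri x y z
          have := between
          have := htour x z
          grind }
    let := linearOrderOfSTO B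
    refine stronglyChordal_of_reversed_arc (p := a) (q := b) (Or.inr ⟨rfl, rfl⟩) fun x y => ?_
    change _ ↔ (B x y ∧ _) ∨ _
    grind
  · push Not at hex
    have hA : IsStrictTotalOrder V A :=
      { trichotomous := fun x y hxy hyx => by_contra fun hne => (total hne).elim hxy hyx
        irrefl := hirr
        trans := by
          intro x y z hxy hyz
          have ne : ∀ {s t}, A s t → s ≠ t := by rintro s t hst rfl; exact hirr _ hst
          have hxz : x ≠ z := by rintro rfl; exact asymm hxy hyz
          exact (total hxz).resolve_right fun hzx =>
            hex x y z ⟨ne hxy, ne hyz, ne hzx, hxy, hyz, hzx⟩ }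
    let := linearOrderOfSTO A
    exact stronglyChordal_of_linearOrder fun _ _ => Iff.rfl

end Sufficiency

theorem stmt_10 {V : Type*} [Fintype V] (A : V → V → Prop)
    (htour : ∀ u v : V, u ≠ v → (A u v ↔ ¬ A v u))
    (hirr : ∀ v : V, ¬ A v v) :
    StronglyChordal A ↔
      ¬ ∃ u v w x y z : V, DirTriangle A u v w ∧ DirTriangle A x y z ∧
        ({(u, v), (v, w), (w, u)} : Set (V × V)) ∩ {(x, y), (y, z), (z, x)} = ∅ := by
  constructor
  · rintro ⟨r, hr⟩ ⟨u, v, w, x, y, z, h₁, h₂, hd⟩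
    exact hr.triangleArcs_inter_ne_empty htour hirr h₁ h₂ hd
  · exact fun h => stronglyChordal_of_share htour hirr fun u v w x y z h₁ h₂ hd =>
      h ⟨u, v, w, x, y, z, h₁, h₂, hd⟩
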